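/- arXiv:2403.02197 — 2 statements merged into one kernel-verified Lean document; each statement's English description precedes it below -/
import Mathlib

section
/- Let G be a finite group and p a prime, and let p^k be the largest power of p dividing |G|. Then G has a normal Sylow p-subgroup if and only if the number of elements g ∈ G with g^{p^k} = 1 equals p^k. -/
/-- The elements of a Sylow `p`-subgroup have order dividing the order of the subgroup. -/
theorem Sylow.coe_subset_setOf_pow_card_eq_one {G : Type*} [Group G] {p : ℕ} (P : Sylow p G) :
    (P : Set G) ⊆ {g : G | g ^ Nat.card P = 1} := fun g hg =>
  congrArg Subtype.val (pow_card_eq_one' (x := (⟨g, hg⟩ : P)))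

/-- A normal Sylow `p`-subgroup contains every element of `p`-power order. -/
theorem Sylow.mem_of_pow_eq_one_of_normal {G : Type*} [Group G] [Finite G] {p : ℕ}
    [Fact p.Prime] (P : Sylow p G) [(P : Subgroup G).Normal] {g : G} {n : ℕ}
    (hg : g ^ p ^ n = 1) : g ∈ P := by
  have h : IsPGroup p (Subgroup.zpowers g) := by
    obtain ⟨m, -, hm⟩ := (Nat.dvd_prime_pow Fact.out).1 (orderOf_dvd_of_pow_eq_one hg)
    exact IsPGroup.of_card ((Nat.card_zpowers g).trans hm)
  obtain ⟨Q, hQ⟩ := h.exists_le_sylow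
  have := Sylow.unique_of_normal P ‹_›
  exact Subsingleton.elim Q P ▸ hQ (Subgroup.mem_zpowers g)

/-- Let `G` be a finite group, `p` a prime, and `p ^ k` the largest power of `p`
dividing `|G|`. Then `G` has a normal Sylow `p`-subgroup if and only if the number
of elements `g ∈ G` with `g ^ (p ^ k) = 1` equals `p ^ k`. -/
theorem normal_sylow_iff_card_pow_eq (G : Type*) [Group G] [Finite G] (p k : ℕ)
    (hp : p.Prime) (hk : k = (Nat.card G).factorization p) :
    (∃ P : Sylow p G, (P : Subgroup G).Normal) ↔
      Nat.card {g : G // g ^ (p ^ k) = 1} = p ^ k := by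
  have : Fact p.Prime := ⟨hp⟩
  have card_eq (P : Sylow p G) : Nat.card P = p ^ k := hk ▸ P.card_eq_multiplicity
  constructor
  · rintro ⟨P, hP⟩
    rw [← card_eq P]
    refine Nat.card_congr (Equiv.subtypeEquivRight fun g =>
      ⟨fun hg => P.mem_of_pow_eq_one_of_normal (card_eq P ▸ hg),
        fun hg => P.coe_subset_setOf_pow_card_eq_one hg⟩)
  · intro h
    let P : Sylow p G := default
    have hPS : (P : Set G) = {g : G | g ^ p ^ k = 1} := by
      refine Set.eq_of_subset_of_ncard_le (card_eq P ▸ P.coe_subset_setOf_pow_card_eq_one) ?_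
      exact (h.trans (card_eq P).symm).le
    refine ⟨P, ⟨fun n hn g => ?_⟩⟩
    have mem_iff (x : G) : x ∈ (P : Subgroup G) ↔ x ^ p ^ k = 1 := Set.ext_iff.1 hPS x
    rw [mem_iff] at hn ⊢
    rw [conj_pow, hn, mul_one, mul_inv_cancel]
end

section
/- If G and H are finite groups with the same order type (i.e., for every natural number n the number of elements of order n in G equals the number of elements of order n in H) and G is nilpotent, then H is nilpotent. In other words, the order type can distinguish nilpotent groups from non-nilpotent ones. -/
/-- Two finite groups with the same order type admit an order-preserving bijection. -/
theorem exists_equiv_orderOf_eq {G H : Type*} [Group G] [Group H] [Finite G] [Finite H]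
    (h : ∀ n : ℕ, Nat.card {g : G // orderOf g = n} = Nat.card {h : H // orderOf h = n}) :
    ∃ e : G ≃ H, ∀ g, orderOf (e g) = orderOf g :=
  ⟨Equiv.ofFiberEquiv fun n => (Finite.card_eq.mp (h n)).some, fun g => Equiv.ofFiberEquiv_map _ g⟩

/-- A normal Sylow `p`-subgroup contains every element of `p`-power order. -/
theorem Sylow.mem_of_orderOf_eq_pow {G : Type*} [Group G] [Finite G] {p : ℕ} [Fact p.Prime]
    (P : Sylow p G) (hP : (P : Subgroup G).Normal) {x : G} {k : ℕ} (hx : orderOf x = p ^ k) :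
    x ∈ P := by
  have hz : IsPGroup p (Subgroup.zpowers x) :=
    IsPGroup.of_card (n := k) (by rw [Nat.card_zpowers, hx])
  obtain ⟨Q, hQ⟩ := hz.exists_le_sylow
  have := Sylow.unique_of_normal P hP
  rw [Subsingleton.elim P Q]
  exact hQ (Subgroup.mem_zpowers x)

/-- A Sylow `p`-subgroup is normal as soon as there are at most as many elements of `p`-power
order as it has elements. -/
theorem Sylow.normal_of_ncard_le {G : Type*} [Group G] [Finite G] {p : ℕ} [Fact p.Prime]
    (P : Sylow p G) (hP : {x : G | ∃ k, orderOf x = p ^ k}.ncard ≤ Nat.card P) :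
    (P : Subgroup G).Normal := by
  have hsub : (P : Set G) ⊆ {x : G | ∃ k, orderOf x = p ^ k} := fun x hx => by
    obtain ⟨k, hk⟩ := IsPGroup.iff_orderOf.mp P.isPGroup' ⟨x, hx⟩
    exact ⟨k, by rwa [Subgroup.orderOf_mk] at hk⟩
  have heq : (P : Set G) = {x : G | ∃ k, orderOf x = p ^ k} :=
    Set.eq_of_subset_of_ncard_le hsub hP
  have hmem (x : G) : x ∈ (P : Subgroup G) ↔ ∃ k, orderOf x = p ^ k := Set.ext_iff.mp heq x
  refine ⟨fun x hx g => ?_⟩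
  rw [hmem] at hx ⊢
  rwa [← MulAut.conj_apply, MulEquiv.orderOf_eq]

/-- If finite groups `G` and `H` have the same order type and `G` is nilpotent,
then `H` is nilpotent: the order type distinguishes nilpotent groups. -/
theorem nilpotent_of_same_order_type (G H : Type*) [Group G] [Group H]
    [Finite G] [Finite H]
    (h : ∀ n : ℕ, Nat.card {g : G // orderOf g = n} = Nat.card {h : H // orderOf h = n})
    (hG : Group.IsNilpotent G) : Group.IsNilpotent H := by
  obtain ⟨e, he⟩ := exists_equiv_orderOf_eq h
  refine (Group.isNilpotent_of_finite_tfae.out 0 3 rfl rfl).mpr fun p hp Q => ?_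
  obtain ⟨P⟩ := (inferInstance : Nonempty (Sylow p G))
  have hP : (P : Subgroup G).Normal := inferInstance
  apply Q.normal_of_ncard_le
  have himage : {x : H | ∃ k, orderOf x = p ^ k} ⊆ e '' (P : Set G) := fun x ⟨k, hk⟩ =>
    ⟨e.symm x, P.mem_of_orderOf_eq_pow hP (k := k) (by rw [← he, e.apply_symm_apply, hk]),
      e.apply_symm_apply x⟩
  calc {x : H | ∃ k, orderOf x = p ^ k}.ncard
      ≤ (e '' (P : Set G)).ncard := Set.ncard_le_ncard himage
    _ = Nat.card P := Set.ncard_image_of_injective _ e.injective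
    _ = Nat.card Q := by
      rw [P.card_eq_multiplicity, Q.card_eq_multiplicity, Nat.card_congr e]
end
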